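/- arXiv:1610.05471 — 3 statements merged into one kernel-verified Lean document; each statement's English description precedes it below -/
import Mathlib

section
/- Fix a signal-to-noise ratio γ > 0 and a communication cost c > 0. Define J(β) = 2∫_0^β x² p(x) dx + (2/(γ+1))·V(β) + 2c·∫_β^∞ p(x) dx for β ≥ 0, where V(β) = ∫_β^∞ x² p(x) dx − (∫_β^∞ x p(x) dx)²/(∫_β^∞ p(x) dx). Then there exists a unique β* ≥ 0 satisfying (β*)² = (1/(γ+1))·G(β*)² + c, and this β* is the unique global minimizer of J over [0,∞): J(β*) < J(β) for every β ≥ 0 with β ≠ β*. -/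
open MeasureTheory Set

theorem setIntegral_Ioi_comp_add_right (f : ℝ → ℝ) (b d : ℝ) :
    ∫ x in Ioi b, f (x + d) = ∫ x in Ioi (b + d), f x := by
  have h := (measurePreserving_add_right volume d).setIntegral_preimage_emb
    (measurableEmbedding_addRight d) f (Ioi (b + d))
  simpa using h

theorem setIntegral_Ioi_eq_sub_intervalIntegral {f : ℝ → ℝ} (hf : Integrable f) :
    (fun β => ∫ x in Ioi β, f x) =
      fun β => (∫ x in Ioi 0, f x) - ∫ x in (0 : ℝ)..β, f x := by
  funext β
  rw [← intervalIntegral.integral_Ioi_sub_Ioi' hf.integrableOn hf.integrableOn, sub_sub_cancel]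

theorem hasDerivAt_setIntegral_Ioi {f : ℝ → ℝ} (hf : Integrable f) {b : ℝ}
    (hb : ContinuousAt f b) :
    HasDerivAt (fun β => ∫ x in Ioi β, f x) (-f b) b := by
  rw [setIntegral_Ioi_eq_sub_intervalIntegral hf]
  exact (intervalIntegral.integral_hasDerivAt_right hf.intervalIntegrable
    hf.aestronglyMeasurable.stronglyMeasurableAtFilter hb).const_sub _

theorem continuous_setIntegral_Ioi {f : ℝ → ℝ} (hf : Integrable f) :
    Continuous (fun β => ∫ x in Ioi β, f x) := by
  rw [setIntegral_Ioi_eq_sub_intervalIntegral hf]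
  exact continuous_const.sub
    (intervalIntegral.continuous_primitive (fun _ _ => hf.intervalIntegrable) 0)

/-- The monotone likelihood ratio property of a positive log-concave function. -/
theorem mul_le_mul_of_logConcave {p : ℝ → ℝ} (hpos : ∀ x, 0 < p x)
    (hlogconcave : ∀ x y θ : ℝ, 0 ≤ θ → θ ≤ 1 →
      p x ^ θ * p y ^ (1 - θ) ≤ p (θ * x + (1 - θ) * y))
    {u v d : ℝ} (huv : u ≤ v) (hd : 0 ≤ d) :
    p (v + d) * p u ≤ p (u + d) * p v := by
  rcases hd.eq_or_lt with rfl | hd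
  · simp [mul_comm]
  have hs : 0 < v - u + d := by linarith
  set θ := d / (v - u + d) with hθ
  have hθ0 : 0 ≤ θ := by positivity
  have hθ1 : θ ≤ 1 := (div_le_one hs).2 (by linarith)
  have hθs : θ * (v - u + d) = d := by rw [hθ]; field_simp
  have h1 := hlogconcave u (v + d) θ hθ0 hθ1
  have h2 := hlogconcave (v + d) u θ hθ0 hθ1
  rw [show θ * u + (1 - θ) * (v + d) = v by linarith] at h1
  rw [show θ * (v + d) + (1 - θ) * u = u + d by linarith] at h2
  have split (x : ℝ) : p x ^ θ * p x ^ (1 - θ) = p x := by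
    rw [← Real.rpow_add (hpos x)]; simp
  calc p (v + d) * p u
      = (p (v + d) ^ θ * p u ^ (1 - θ)) * (p u ^ θ * p (v + d) ^ (1 - θ)) := by
        conv_lhs => rw [← split (v + d), ← split u]
        ring
    _ ≤ p (u + d) * p v :=
        mul_le_mul h2 h1 (mul_nonneg (Real.rpow_nonneg (hpos _).le _)
          (Real.rpow_nonneg (hpos _).le _)) (hpos _).le

theorem setIntegral_Ioi_pos {p : ℝ → ℝ} (hpos : ∀ x, 0 < p x) (hp : Integrable p) (b : ℝ) :
    0 < ∫ x in Ioi b, p x := by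
  rw [setIntegral_pos_iff_support_of_nonneg_ae (ae_of_all _ fun x => (hpos x).le) hp.integrableOn,
    show Function.support p = univ from eq_univ_of_forall fun x => (hpos x).ne']
  simp

/-- The mean residual life of a log-concave density is antitone. -/
theorem antitone_meanResidualLife {p : ℝ → ℝ} (hpos : ∀ x, 0 < p x)
    (hlogconcave : ∀ x y θ : ℝ, 0 ≤ θ → θ ≤ 1 →
      p x ^ θ * p y ^ (1 - θ) ≤ p (θ * x + (1 - θ) * y))
    (hp : Integrable p) (hxp : Integrable fun x => x * p x) :
    Antitone fun β => (∫ x in Ioi β, x * p x) / (∫ x in Ioi β, p x) - β := by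
  intro b b' hbb'
  obtain ⟨d, hd, rfl⟩ : ∃ d, 0 ≤ d ∧ b' = b + d := ⟨b' - b, by linarith, by ring⟩
  have hS := setIntegral_Ioi_pos hpos hp b
  have hS' := setIntegral_Ioi_pos hpos hp (b + d)
  set a := (∫ x in Ioi b, x * p x) / (∫ x in Ioi b, p x) with ha
  have centered (e s : ℝ) : ∫ x in Ioi s, (x - e) * p x =
      (∫ x in Ioi s, x * p x) - e * ∫ x in Ioi s, p x := by
    simp only [sub_mul]
    rw [integral_sub hxp.integrableOn (hp.const_mul e).integrableOn, integral_const_mul]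
  have hint (e : ℝ) : Integrable fun x => (x - e) * p x := by
    simp only [sub_mul]
    exact hxp.sub (hp.const_mul e)
  have hle : ∫ x in Ioi b, p a * ((x + d - (a + d)) * p (x + d)) ≤
      ∫ x in Ioi b, p (a + d) * ((x - a) * p x) := by
    refine integral_mono (((hint (a + d)).comp_add_right d).const_mul _).integrableOn
      ((hint a).const_mul _).integrableOn fun x => ?_
    rcases le_total a x with hx | hx <;>
      nlinarith [mul_le_mul_of_logConcave hpos hlogconcave hx hd]
  rw [integral_const_mul, integral_const_mul, centered,
    setIntegral_Ioi_comp_add_right (fun x => (x - (a + d)) * p x), centered,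
    ha, div_mul_cancel₀ _ hS.ne', sub_self, mul_zero, ← ha] at hle
  have hle' := nonpos_of_mul_nonpos_right hle (hpos a)
  have : (∫ x in Ioi (b + d), x * p x) / (∫ x in Ioi (b + d), p x) ≤ a + d := by
    rw [div_le_iff₀ hS']; linarith
  show _ / _ - (b + d) ≤ a - b
  linarith

theorem meanResidualLife_nonneg {p : ℝ → ℝ} (hpos : ∀ x, 0 < p x)
    (hp : Integrable p) (hxp : Integrable fun x => x * p x) (β : ℝ) :
    0 ≤ (∫ x in Ioi β, x * p x) / (∫ x in Ioi β, p x) - β := by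
  rw [sub_nonneg, le_div_iff₀ (setIntegral_Ioi_pos hpos hp β), ← integral_const_mul]
  exact setIntegral_mono_on (hp.const_mul β).integrableOn hxp.integrableOn measurableSet_Ioi
    fun x hx => mul_le_mul_of_nonneg_right (le_of_lt hx) (hpos x).le

/-- Theorem 2 (optimal threshold): there is a unique β* ≥ 0 solving the
fixed-point equation, and it is the unique global minimizer of J on [0,∞). -/
theorem stmt1
    (p : ℝ → ℝ)
    (hmeas : Measurable p)
    (hnonneg : ∀ x, 0 ≤ p x)
    (hint : (∫ x, p x) = 1)
    (heven : ∀ x, p (-x) = p x)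
    (hpos : ∀ x, 0 < p x)
    (hlogconcave : ∀ x y θ : ℝ, 0 ≤ θ → θ ≤ 1 →
      p x ^ θ * p y ^ (1 - θ) ≤ p (θ * x + (1 - θ) * y))
    (hC1 : ContDiffOn ℝ 1 p (Ioi 0))
    (hmom2 : Integrable (fun x => x ^ 2 * p x))
    (γ c : ℝ) (hγ : 0 < γ) (hc : 0 < c)
    (G : ℝ → ℝ)
    (hG : ∀ β, G β = (∫ x in Ioi β, x * p x) / (∫ x in Ioi β, p x) - β)
    (V : ℝ → ℝ)
    (hV : ∀ β, V β = (∫ x in Ioi β, x ^ 2 * p x) -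
      (∫ x in Ioi β, x * p x) ^ 2 / (∫ x in Ioi β, p x))
    (J : ℝ → ℝ)
    (hJ : ∀ β, J β = 2 * (∫ x in Ioc 0 β, x ^ 2 * p x) +
      2 / (γ + 1) * V β + 2 * c * (∫ x in Ioi β, p x)) :
    ∃ βstar : ℝ, 0 ≤ βstar ∧
      βstar ^ 2 = 1 / (γ + 1) * G βstar ^ 2 + c ∧
      (∀ β : ℝ, 0 ≤ β → β ^ 2 = 1 / (γ + 1) * G β ^ 2 + c → β = βstar) ∧
      (∀ β : ℝ, 0 ≤ β → β ≠ βstar → J βstar < J β) := by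
  have hp : Integrable p := by
    by_contra h
    simp [integral_undef h] at hint
  have hxp : Integrable fun x => x * p x := by
    refine (hp.add hmom2).mono' (measurable_id.mul hmeas).aestronglyMeasurable
      (ae_of_all _ fun x => ?_)
    have hx : |x| ≤ 1 + x ^ 2 := by
      rw [← sq_abs]; nlinarith [sq_nonneg (|x| - 1)]
    simp only [Pi.add_apply, norm_mul, Real.norm_eq_abs, abs_of_nonneg (hnonneg x)]
    nlinarith [mul_le_mul_of_nonneg_right hx (hnonneg x)]
  have hS := setIntegral_Ioi_pos hpos hp
  have hSc := continuous_setIntegral_Ioi hp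
  have hMc := continuous_setIntegral_Ioi hxp
  have hQc := continuous_setIntegral_Ioi hmom2
  obtain rfl : G = fun β => (∫ x in Ioi β, x * p x) / (∫ x in Ioi β, p x) - β := funext hG
  have hGanti := antitone_meanResidualLife hpos hlogconcave hp hxp
  have hGnonneg := meanResidualLife_nonneg hpos hp hxp
  have hGc : Continuous fun β => (∫ x in Ioi β, x * p x) / (∫ x in Ioi β, p x) - β :=
    (hMc.div hSc fun β => (hS β).ne').sub continuous_id
  clear hG
  set G := fun β => (∫ x in Ioi β, x * p x) / (∫ x in Ioi β, p x) - β with hG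
  have hγ' : 0 < 1 / (γ + 1) := by positivity
  set H := fun β => β ^ 2 - (1 / (γ + 1) * G β ^ 2 + c) with hH
  have hHc : Continuous H := by fun_prop
  have hHmono : StrictMonoOn H (Ici 0) := by
    intro x hx y hy hxy
    have h1 : G y ^ 2 ≤ G x ^ 2 := pow_le_pow_left₀ (hGnonneg y) (hGanti hxy.le) 2
    have h2 : x ^ 2 < y ^ 2 := pow_lt_pow_left₀ hxy hx two_ne_zero
    have h3 := mul_le_mul_of_nonneg_left h1 hγ'.le
    simp only [hH]
    linarith
  obtain ⟨β₀, hβ₀, hHβ₀⟩ : ∃ β, 0 ≤ β ∧ H β = 0 := by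
    set B := 1 / (γ + 1) * G 0 ^ 2 + c + 1 with hB
    have hG0 : 0 ≤ 1 / (γ + 1) * G 0 ^ 2 := by positivity
    have hB1 : 1 ≤ B := by linarith
    have hHB : 0 ≤ H B := by
      have h1 : G B ^ 2 ≤ G 0 ^ 2 := pow_le_pow_left₀ (hGnonneg B) (hGanti (by linarith)) 2
      have h2 := mul_le_mul_of_nonneg_left h1 hγ'.le
      simp only [hH]
      nlinarith
    have hH0 : H 0 ≤ 0 := by
      simp only [hH]
      linarith
    obtain ⟨β, hβ, h⟩ := intermediate_value_Icc (by linarith : (0 : ℝ) ≤ B) hHc.continuousOn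
      (show (0 : ℝ) ∈ Icc (H 0) (H B) from ⟨hH0, hHB⟩)
    exact ⟨β, hβ.1, h⟩
  set K : ℝ → ℝ := fun β =>
    2 * ((∫ x in Ioi 0, x ^ 2 * p x) - ∫ x in Ioi β, x ^ 2 * p x) +
      2 / (γ + 1) * ((∫ x in Ioi β, x ^ 2 * p x) -
        (∫ x in Ioi β, x * p x) ^ 2 / (∫ x in Ioi β, p x)) +
      2 * c * (∫ x in Ioi β, p x) with hK
  have hJK : ∀ β, 0 ≤ β → J β = K β := by
    intro β hβ
    rw [hJ, hV, hK, ← intervalIntegral.integral_of_le hβ,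
      ← intervalIntegral.integral_Ioi_sub_Ioi hmom2.integrableOn hβ]
  have hKc : Continuous K :=
    ((continuous_const.mul (continuous_const.sub hQc)).add
      (continuous_const.mul (hQc.sub ((hMc.pow 2).div hSc fun β => (hS β).ne')))).add
      (continuous_const.mul hSc)
  have hK' : ∀ β, 0 < β → HasDerivAt K (2 * p β * H β) β := by
    intro β hβ
    have hpc : ContinuousAt p β := hC1.continuousOn.continuousAt (Ioi_mem_nhds hβ)
    have dS := hasDerivAt_setIntegral_Ioi hp hpc
    have dM := hasDerivAt_setIntegral_Ioi hxp (continuousAt_id.mul hpc)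
    have dQ := hasDerivAt_setIntegral_Ioi hmom2 ((continuousAt_id.pow 2).mul hpc)
    have hne := (hS β).ne'
    have hγne : γ + 1 ≠ 0 := by positivity
    refine HasDerivAt.congr_deriv ((((dQ.const_sub (∫ x in Ioi 0, x ^ 2 * p x)).const_mul 2).add
      ((dQ.sub ((dM.pow 2).div dS hne)).const_mul (2 / (γ + 1)))).add
      (dS.const_mul (2 * c))) ?_
    simp only [hH, hG, Pi.pow_apply]
    push_cast
    field_simp
    ring
  have hsign : ∀ β, 0 ≤ β → (β < β₀ → H β < 0) ∧ (β₀ < β → 0 < H β) := fun β hβ =>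
    ⟨fun h => hHβ₀ ▸ hHmono hβ hβ₀ h, fun h => hHβ₀ ▸ hHmono hβ₀ hβ h⟩
  refine ⟨β₀, hβ₀, by simpa only [hH, sub_eq_zero] using hHβ₀, fun β hβ h => ?_, fun β hβ hne => ?_⟩
  · exact hHmono.injOn hβ hβ₀ ((sub_eq_zero.2 h).trans hHβ₀.symm)
  · rw [hJK β hβ, hJK β₀ hβ₀]
    rcases hne.lt_or_gt with h | h
    · refine strictAntiOn_of_deriv_neg (convex_Icc 0 β₀) hKc.continuousOn (fun x hx => ?_)
        ⟨hβ, h.le⟩ ⟨hβ₀, le_rfl⟩ h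
      rw [interior_Icc] at hx
      rw [(hK' x hx.1).deriv]
      exact mul_neg_of_pos_of_neg (by linarith [hpos x]) ((hsign x hx.1.le).1 hx.2)
    · refine strictMonoOn_of_deriv_pos (convex_Ici β₀) hKc.continuousOn (fun x hx => ?_)
        self_mem_Ici h.le h
      rw [interior_Ici] at hx
      have hx0 : 0 < x := hβ₀.trans_lt hx
      rw [(hK' x hx0).deriv]
      exact mul_pos (by linarith [hpos x]) ((hsign x hx0.le).2 hx)
end

section
/- For every measurable partition of ℝ into sets T₀, T₊ ⊆ (0,∞), T₋ ⊆ (−∞,0), each of positive p-measure and satisfying the conditional-mean ordering m(T₋) < m(T₀) < m(T₊), there exist β₁ ≥ 0 and β₂ ≥ 0 such that, setting T₀′ = (−β₂,β₁), T₊′ = (β₁,∞), T₋′ = (−∞,−β₂), one has P(Tᵢ′) = P(Tᵢ) for each i ∈ {0,+,−} and Var(T₀′)·P(T₀′) + Var(T₊′)·P(T₊′) + Var(T₋′)·P(T₋′) ≤ Var(T₀)·P(T₀) + Var(T₊)·P(T₊) + Var(T₋)·P(T₋). (Lemma 2: a two-threshold partition matching all three region probabilities has no larger three-level quantizer distortion.)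 -/
open MeasureTheory Set

theorem exists_nonneg_setIntegral_Ioi_eq {p : ℝ → ℝ} (hp : Integrable p) {c : ℝ} (hc : 0 < c)
    (hc' : c ≤ ∫ x in Ioi 0, p x) : ∃ β : ℝ, 0 ≤ β ∧ ∫ x in Ioi β, p x = c := by
  have key : ∀ t : ℝ, ∫ x in Ioi t, p x = (∫ x in Ioi 0, p x) - ∫ x in (0 : ℝ)..t, p x := by
    intro t
    rw [← intervalIntegral.integral_Ioi_sub_Ioi' hp.integrableOn hp.integrableOn]
    ring
  have hcont : Continuous fun t : ℝ => ∫ x in Ioi t, p x := by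
    rw [funext key]
    exact continuous_const.sub
      (intervalIntegral.continuous_primitive (fun _ _ => hp.intervalIntegrable) 0)
  have hlim : Filter.Tendsto (fun t : ℝ => ∫ x in Ioi t, p x) Filter.atTop (nhds 0) := by
    rw [funext key]
    have := intervalIntegral_tendsto_integral_Ioi 0 hp.integrableOn Filter.tendsto_id
    simpa using this.const_sub (∫ x in Ioi 0, p x)
  obtain ⟨t, ht, ht0⟩ := ((hlim.eventually (gt_mem_nhds hc)).and
    (Filter.eventually_ge_atTop 0)).exists
  obtain ⟨β, hβ, h⟩ := intermediate_value_Icc' ht0 hcont.continuousOn ⟨ht.le, hc'⟩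
  exact ⟨β, hβ.1, h⟩

theorem setIntegral_Iio_add_Ioo_add_Ioi {f : ℝ → ℝ} (hf : Integrable f) {l u : ℝ} (h : l ≤ u) :
    (∫ x in Iio l, f x) + (∫ x in Ioo l u, f x) + ∫ x in Ioi u, f x = ∫ x, f x := by
  rw [← integral_Iic_eq_integral_Iio, ← integral_Ioc_eq_integral_Ioo,
    ← setIntegral_union (Iic_disjoint_Ioc le_rfl) measurableSet_Ioc hf.integrableOn hf.integrableOn,
    Iic_union_Ioc_eq_Iic h, ← compl_Iic]
  exact integral_add_compl measurableSet_Iic hf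

/-- Among sets of given mass, the upper half-line has the largest first moment. -/
theorem setIntegral_id_mul_le_Ioi {p : ℝ → ℝ} (hp0 : ∀ x, 0 ≤ p x) (hp : Integrable p)
    (hxp : Integrable fun x => x * p x) {T : Set ℝ} (hT : MeasurableSet T) {β : ℝ}
    (h : ∫ x in Ioi β, p x = ∫ x in T, p x) :
    ∫ x in T, x * p x ≤ ∫ x in Ioi β, x * p x := by
  have hg : Integrable fun x => x * p x - β * p x := hxp.sub (hp.const_mul β)
  have hle : ∫ x in T, (x * p x - β * p x) ≤ ∫ x in Ioi β, (x * p x - β * p x) := by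
    rw [← integral_indicator hT, ← integral_indicator measurableSet_Ioi]
    refine integral_mono (hg.indicator hT) (hg.indicator measurableSet_Ioi) fun x => ?_
    have := hp0 x
    by_cases h1 : x ∈ T <;> by_cases h2 : β < x <;> simp [indicator, h1, h2] <;> nlinarith
  rw [integral_sub hxp.integrableOn (hp.const_mul β).integrableOn,
    integral_sub hxp.integrableOn (hp.const_mul β).integrableOn,
    integral_const_mul, integral_const_mul, h] at hle
  linarith

/-- Among sets of given mass, the lower half-line has the smallest first moment. -/
theorem setIntegral_Iio_le_id_mul {p : ℝ → ℝ} (hp0 : ∀ x, 0 ≤ p x) (hp : Integrable p)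
    (hxp : Integrable fun x => x * p x) {T : Set ℝ} (hT : MeasurableSet T) {γ : ℝ}
    (h : ∫ x in Iio γ, p x = ∫ x in T, p x) :
    ∫ x in Iio γ, x * p x ≤ ∫ x in T, x * p x := by
  have hg : Integrable fun x => x * p x - γ * p x := hxp.sub (hp.const_mul γ)
  have hle : ∫ x in Iio γ, (x * p x - γ * p x) ≤ ∫ x in T, (x * p x - γ * p x) := by
    rw [← integral_indicator hT, ← integral_indicator measurableSet_Iio]
    refine integral_mono (hg.indicator measurableSet_Iio) (hg.indicator hT) fun x => ?_
    have := hp0 x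
    by_cases h1 : x ∈ T <;> by_cases h2 : x < γ <;> simp [indicator, h1, h2] <;> nlinarith
  rw [integral_sub hxp.integrableOn (hp.const_mul γ).integrableOn,
    integral_sub hxp.integrableOn (hp.const_mul γ).integrableOn,
    integral_const_mul, integral_const_mul, h] at hle
  linarith

theorem integrable_id_mul_of_sq {p : ℝ → ℝ} (hp0 : ∀ x, 0 ≤ p x) (hp : Integrable p)
    (hp2 : Integrable fun x => x ^ 2 * p x) : Integrable fun x => x * p x := by
  refine (hp.add hp2).mono' (continuous_id.aestronglyMeasurable.mul hp.1) (.of_forall fun x => ?_)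
  have hx : |x| ≤ 1 + x ^ 2 := by nlinarith [sq_nonneg (|x| - 1), sq_abs x, abs_nonneg x]
  have := mul_le_mul_of_nonneg_right hx (hp0 x)
  simp only [Real.norm_eq_abs, abs_mul, abs_of_nonneg (hp0 x), Pi.add_apply]
  linarith



/-- Lemma 2: a two-threshold partition matching all three region
probabilities has no larger three-level quantizer distortion. -/
theorem stmt5
    (p : ℝ → ℝ)
    (hmeas : Measurable p)
    (hnonneg : ∀ x, 0 ≤ p x)
    (hint : (∫ x, p x) = 1)
    (heven : ∀ x, p (-x) = p x)
    (hpos : ∀ x, 0 < p x)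
    (hmom2 : Integrable (fun x => x ^ 2 * p x))
    (P : Set ℝ → ℝ) (hP : ∀ S, P S = ∫ x in S, p x)
    (m : Set ℝ → ℝ) (hm : ∀ S, m S = (∫ x in S, x * p x) / P S)
    (Var : Set ℝ → ℝ)
    (hVar : ∀ S, Var S = (∫ x in S, x ^ 2 * p x) / P S - m S ^ 2)
    (T0 Tp Tm : Set ℝ)
    (hT0meas : MeasurableSet T0) (hTpmeas : MeasurableSet Tp)
    (hTmmeas : MeasurableSet Tm)
    (hTpsub : Tp ⊆ Ioi 0) (hTmsub : Tm ⊆ Iio 0)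
    (hd0p : Disjoint T0 Tp) (hd0m : Disjoint T0 Tm) (hdpm : Disjoint Tp Tm)
    (hunion : T0 ∪ Tp ∪ Tm = univ)
    (hP0 : 0 < P T0) (hPp : 0 < P Tp) (hPm : 0 < P Tm)
    (horder1 : m Tm < m T0) (horder2 : m T0 < m Tp) :
    ∃ β₁ β₂ : ℝ, 0 ≤ β₁ ∧ 0 ≤ β₂ ∧
      P (Ioo (-β₂) β₁) = P T0 ∧
      P (Ioi β₁) = P Tp ∧
      P (Iio (-β₂)) = P Tm ∧
      Var (Ioo (-β₂) β₁) * P (Ioo (-β₂) β₁) + Var (Ioi β₁) * P (Ioi β₁) +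
          Var (Iio (-β₂)) * P (Iio (-β₂)) ≤
        Var T0 * P T0 + Var Tp * P Tp + Var Tm * P Tm := by

  have hp : Integrable p := by
    by_contra h
    simp [integral_undef h] at hint
  have hxp := integrable_id_mul_of_sq hnonneg hp hmom2
  have hsplit : ∀ f : ℝ → ℝ, Integrable f →
      (∫ x in T0, f x) + (∫ x in Tp, f x) + ∫ x in Tm, f x = ∫ x, f x := by
    intro f hf
    rw [← setIntegral_union hd0p hTpmeas hf.integrableOn hf.integrableOn,
      ← setIntegral_union (hd0m.union_left hdpm) hTmmeas hf.integrableOn hf.integrableOn,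
      hunion, setIntegral_univ]
  have hneg : ∀ t, ∫ x in Iio (-t), p x = ∫ x in Ioi t, p x := by
    intro t
    rw [← integral_Iic_eq_integral_Iio, ← integral_comp_neg_Ioi]
    simp only [heven]
  have hmono : ∀ S T : Set ℝ, MeasurableSet T → S ⊆ T →
      ∫ x in S, p x ≤ ∫ x in T, p x := fun S T hT h =>
    setIntegral_mono_set hp.integrableOn (.of_forall hnonneg) (.of_forall h)
  obtain ⟨β₁, hβ₁, h1⟩ := exists_nonneg_setIntegral_Ioi_eq hp (hP Tp ▸ hPp)
    (hmono _ _ measurableSet_Ioi hTpsub)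
  obtain ⟨β₂, hβ₂, h2⟩ := exists_nonneg_setIntegral_Ioi_eq hp (hP Tm ▸ hPm)
    (by simpa [← hneg] using hmono _ _ measurableSet_Iio hTmsub)
  rw [← hneg] at h2
  have hle : -β₂ ≤ β₁ := by linarith
  have hI1 := setIntegral_id_mul_le_Ioi hnonneg hp hxp hTpmeas h1
  have hI2 := setIntegral_Iio_le_id_mul hnonneg hp hxp hTmmeas h2
  have e0 : P (Ioo (-β₂) β₁) = P T0 := by
    rw [hP, hP]
    linarith [hsplit p hp, setIntegral_Iio_add_Ioo_add_Ioi hp hle]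
  have e1 : P (Ioi β₁) = P Tp := by rw [hP, hP, h1]
  have e2 : P (Iio (-β₂)) = P Tm := by rw [hP, hP, h2]
  refine ⟨β₁, β₂, hβ₁, hβ₂, e0, e1, e2, ?_⟩
  have hI : ∀ S, P S ≠ 0 → ∫ x in S, x * p x = m S * P S := fun S h => by
    rw [hm, div_mul_cancel₀ _ h]
  have hV : ∀ S, P S ≠ 0 → Var S * P S = (∫ x in S, x ^ 2 * p x) - m S ^ 2 * P S :=
    fun S h => by rw [hVar, sub_mul, div_mul_cancel₀ _ h]
  have s1 := hsplit _ hxp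
  have s1' := setIntegral_Iio_add_Ioo_add_Ioi hxp hle
  have s2 := hsplit _ hmom2
  have s2' := setIntegral_Iio_add_Ioo_add_Ioi hmom2 hle
  have n0 := e0 ▸ hP0.ne'
  have n1 := e1 ▸ hPp.ne'
  have n2 := e2 ▸ hPm.ne'
  rw [hV _ n0, hV _ n1, hV _ n2, hV _ hP0.ne', hV _ hPp.ne', hV _ hPm.ne']
  rw [hI _ n0, hI _ n1, hI _ n2] at s1'
  rw [hI _ hP0.ne', hI _ hPp.ne', hI _ hPm.ne'] at s1
  rw [hI _ n1, hI _ hPp.ne'] at hI1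
  rw [hI _ n2, hI _ hPm.ne'] at hI2
  rw [e0, e1, e2] at s1' ⊢
  rw [e1] at hI1
  rw [e2] at hI2
  have q0 := mul_nonneg hP0.le (sq_nonneg (m (Ioo (-β₂) β₁) - m T0))
  have q1 := mul_nonneg hPp.le (sq_nonneg (m (Ioi β₁) - m Tp))
  have q2 := mul_nonneg hPm.le (sq_nonneg (m (Iio (-β₂)) - m Tm))
  have r1 := mul_nonneg (sub_nonneg.2 horder2.le) (sub_nonneg.2 hI1)
  have r2 := mul_nonneg (sub_nonneg.2 horder1.le) (sub_nonneg.2 hI2)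
  have r0 := congrArg (m T0 * ·) (s1'.trans s1.symm)
  nlinarith
end

section
/- Define V(γ) = ∫_γ^∞ x² p(x) dx − (∫_γ^∞ x p(x) dx)²/(∫_γ^∞ p(x) dx), the truncated conditional variance times tail probability. Then for every γ₁ > 0 at which p is continuous and ∫_{γ₁}^∞ p > 0, V is differentiable at γ₁ with V′(γ₁) = −p(γ₁)·(γ₁ − E[X | X > γ₁])², where E[X | X > γ₁] = (∫_{γ₁}^∞ x p(x) dx)/(∫_{γ₁}^∞ p(x) dx). (Computation (6) in the proof of Proposition 1.) -/
open MeasureTheory Set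

/-- A tail integral has derivative `-f a` at every continuity point `a` of the integrand. -/
theorem hasDerivAt_integral_Ioi {f : ℝ → ℝ} {a : ℝ} (hf : Integrable f)
    (hfa : ContinuousAt f a) :
    HasDerivAt (fun t => ∫ x in Ioi t, f x) (-(f a)) a := by
  have h : HasDerivAt (fun t => ∫ x in a..t, f x) (f a) a :=
    intervalIntegral.integral_hasDerivAt_right hf.intervalIntegrable
      hf.aestronglyMeasurable.stronglyMeasurableAtFilter hfa
  refine (h.const_sub (∫ x in Ioi a, f x)).congr_of_eventuallyEq (.of_forall fun t => ?_)
  have := intervalIntegral.integral_Ioi_sub_Ioi' (hf.integrableOn (s := Ioi a))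
    (hf.integrableOn (s := Ioi t))
  simp only
  linarith

/-- A weight with finite zeroth and second moments has a finite first moment. -/
theorem integrable_mul_of_integrable_sq_mul {p : ℝ → ℝ} (hp : Integrable p)
    (hp2 : Integrable (fun x => x ^ 2 * p x)) : Integrable (fun x => x * p x) := by
  refine (hp.norm.add hp2.norm).mono'
    (continuous_id.aestronglyMeasurable.mul hp.aestronglyMeasurable) (.of_forall fun x => ?_)
  simp only [Pi.add_apply, norm_mul, norm_pow]
  nlinarith [norm_nonneg (p x), sq_nonneg (‖x‖ - 1), norm_nonneg x,
    mul_nonneg (norm_nonneg (p x)) (sq_nonneg (‖x‖ - 1)),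
    mul_nonneg (norm_nonneg (p x)) (norm_nonneg x)]

/-- Computation (6): the derivative of the truncated conditional
variance-times-tail-probability V at a continuity point γ₁ > 0 of p is
−p(γ₁)·(γ₁ − E[X | X > γ₁])². -/
theorem stmt11
    (p : ℝ → ℝ)
    (hmeas : Measurable p)
    (hnonneg : ∀ x, 0 ≤ p x)
    (hint : (∫ x, p x) = 1)
    (hmom2 : Integrable (fun x => x ^ 2 * p x))
    (V : ℝ → ℝ)
    (hV : ∀ γ, V γ = (∫ x in Ioi γ, x ^ 2 * p x) -
      (∫ x in Ioi γ, x * p x) ^ 2 / (∫ x in Ioi γ, p x))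
    (γ₁ : ℝ) (hγ₁ : 0 < γ₁)
    (hcont : ContinuousAt p γ₁)
    (htail : 0 < ∫ x in Ioi γ₁, p x) :
    HasDerivAt V
      (-(p γ₁) *
        (γ₁ - (∫ x in Ioi γ₁, x * p x) / (∫ x in Ioi γ₁, p x)) ^ 2) γ₁ := by
  have hp : Integrable p := by
    by_contra h
    rw [integral_undef h] at hint
    exact zero_ne_one hint
  have h0 := hasDerivAt_integral_Ioi hp hcont
  have h1 := hasDerivAt_integral_Ioi (integrable_mul_of_integrable_sq_mul hp hmom2)
    (continuousAt_id.mul hcont)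
  have h2 := hasDerivAt_integral_Ioi hmom2 ((continuousAt_id.pow 2).mul hcont)
  rw [funext hV]
  refine (h2.sub ((h1.pow 2).div h0 htail.ne')).congr_deriv ?_
  have hne := htail.ne'
  simp only [Pi.pow_apply]
  field_simp
  ring
end
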